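/- For r ∈ {1, κ} let T_r := {(r₃, r₄) ∈ k^× × k^× : there exists t ∈ k^× with t ≠ 1, t ≠ −1, t + t⁻¹ = z(r, r₃, r₄), and t = s³ for some s ∈ k^×}. Then ∑_{(r₃,r₄) ∈ T₁} ψ(r₃) − ∑_{(r₃,r₄) ∈ T_κ} ψ(r₃) = −(1 + ε₀)·g(ψ). (This is twice the quantity B₁¹ − B_κ¹ of Lemma A.2 when q ≡ 1 mod 3, twice C₁¹ − C_κ¹ of Lemma A.4 when q ≡ −1 mod 3, and twice D₁¹ − D_κ¹ of Lemma A.5 when the characteristic is 3.) -/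

import Mathlib

section AddCharSums

variable {k : Type} [Field k] [Fintype k] [DecidableEq k]

/-- The number of square roots of `a`, as a complex number. -/
theorem card_filter_sq_eq (hchar : ringChar k ≠ 2) (a : k) :
    ((Finset.univ.filter fun x : k => x ^ 2 = a).card : ℂ) =
      ((quadraticChar k a : ℤ) : ℂ) + 1 := by
  have h := quadraticChar_card_sqrts hchar a
  rw [show {x : k | x ^ 2 = a}.toFinset = Finset.univ.filter fun x : k => x ^ 2 = a by
    ext; simp] at h
  exact_mod_cast h

/-- The quadratic Gauss sum, written additively, equals the one twisted by the quadratic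
character. -/
theorem sum_addChar_sq (hchar : ringChar k ≠ 2) {ψ : AddChar k ℂ} (hψ : ψ ≠ 1) :
    ∑ x : k, ψ (x ^ 2) = ∑ y : k, ψ y * ((quadraticChar k y : ℤ) : ℂ) := by
  have h : ∑ x : k, ψ (x ^ 2) = ∑ y : k, ψ y * (((quadraticChar k y : ℤ) : ℂ) + 1) := by
    rw [← Finset.sum_fiberwise (Finset.univ : Finset k) (fun x => x ^ 2)]
    refine Finset.sum_congr rfl fun y _ => ?_
    rw [← card_filter_sq_eq hchar,
      Finset.sum_congr rfl (g := fun _ => ψ y) (fun x hx => by rw [(Finset.mem_filter.1 hx).2])]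
    simp [mul_comm]
  rw [h]
  simp only [mul_add, mul_one, Finset.sum_add_distrib]
  rw [AddChar.sum_eq_zero_of_ne_one hψ, add_zero]

variable (k) in
/-- The nonzero cubes of `k`. -/
def nonzeroCubes : Finset k :=
  (Finset.univ.filter fun s : k => s ≠ 0).image fun s => s ^ 3

theorem mem_nonzeroCubes {t : k} : t ∈ nonzeroCubes k ↔ ∃ s : k, s ≠ 0 ∧ t = s ^ 3 := by
  simp [nonzeroCubes, eq_comm]

theorem ne_zero_of_mem_nonzeroCubes {t : k} (ht : t ∈ nonzeroCubes k) : t ≠ 0 := by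
  obtain ⟨s, hs, rfl⟩ := mem_nonzeroCubes.1 ht
  exact pow_ne_zero 3 hs

theorem inv_mem_nonzeroCubes {t : k} (ht : t ∈ nonzeroCubes k) : t⁻¹ ∈ nonzeroCubes k := by
  obtain ⟨s, hs, rfl⟩ := mem_nonzeroCubes.1 ht
  exact mem_nonzeroCubes.2 ⟨s⁻¹, inv_ne_zero hs, by rw [inv_pow]⟩

/-- The quadratic character sums to zero over the nonzero cubes. -/
theorem sum_quadraticChar_nonzeroCubes {κ : k} (hκ0 : κ ≠ 0) (hκ : ¬ IsSquare κ) :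
    ∑ t ∈ nonzeroCubes k, quadraticChar k t = 0 := by
  have hκ3 : quadraticChar k (κ ^ 3) = -1 := by
    rw [map_pow, quadraticChar_neg_one_iff_not_isSquare.2 hκ]; norm_num
  have h : ∑ t ∈ nonzeroCubes k, quadraticChar k t =
      ∑ t ∈ nonzeroCubes k, quadraticChar k (κ ^ 3 * t) := by
    symm
    refine Finset.sum_bij' (fun t _ => κ ^ 3 * t) (fun t _ => (κ ^ 3)⁻¹ * t) ?_ ?_ ?_ ?_ ?_
    · intro t ht
      obtain ⟨s, hs, rfl⟩ := mem_nonzeroCubes.1 ht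
      exact mem_nonzeroCubes.2 ⟨κ * s, mul_ne_zero hκ0 hs, by ring⟩
    · intro t ht
      obtain ⟨s, hs, rfl⟩ := mem_nonzeroCubes.1 ht
      exact mem_nonzeroCubes.2 ⟨κ⁻¹ * s, mul_ne_zero (inv_ne_zero hκ0) hs, by
        rw [mul_pow, inv_pow]⟩
    · intro t _
      field_simp
    · intro t _
      field_simp
    · intro t _
      rfl
  simp only [map_mul, hκ3, ← Finset.mul_sum] at h
  linarith

variable (k) in
/-- The nonzero cubes of `k` other than `1` and `-1`. -/
def properCubes : Finset k := ((nonzeroCubes k).erase 1).erase (-1)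

theorem mem_properCubes {t : k} :
    t ∈ properCubes k ↔ t ≠ 0 ∧ t ≠ 1 ∧ t ≠ -1 ∧ ∃ s : k, s ≠ 0 ∧ t = s ^ 3 := by
  rw [properCubes, Finset.mem_erase, Finset.mem_erase, ← mem_nonzeroCubes]
  refine ⟨fun h => ⟨ne_zero_of_mem_nonzeroCubes h.2.2, h.2.1, h.1, h.2.2⟩,
    fun h => ⟨h.2.2.1, h.2.1, h.2.2.2⟩⟩

theorem sum_quadraticChar_properCubes (hchar : ringChar k ≠ 2) {κ : k} (hκ0 : κ ≠ 0)
    (hκ : ¬ IsSquare κ) :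
    ∑ t ∈ properCubes k, quadraticChar k t = -(1 + quadraticChar k (-1)) := by
  have h1 : (1 : k) ∈ nonzeroCubes k := mem_nonzeroCubes.2 ⟨1, one_ne_zero, by ring⟩
  have h2 : (-1 : k) ∈ (nonzeroCubes k).erase 1 :=
    Finset.mem_erase.2 ⟨Ring.neg_one_ne_one_of_char_ne_two hchar,
      mem_nonzeroCubes.2 ⟨-1, neg_ne_zero.2 one_ne_zero, by ring⟩⟩
  have e1 := Finset.add_sum_erase _ (fun t => quadraticChar k t) h1
  have e2 := Finset.add_sum_erase _ (fun t => quadraticChar k t) h2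
  rw [sum_quadraticChar_nonzeroCubes hκ0 hκ] at e1
  simp only [map_one] at e1 e2
  rw [properCubes]
  linarith

/-- A value of `t + t⁻¹` on proper cubes is taken exactly twice. -/
theorem card_filter_add_inv_eq (z : k) :
    ((properCubes k).filter fun t => t + t⁻¹ = z).card =
      if ∃ t ∈ properCubes k, t + t⁻¹ = z then 2 else 0 := by
  split_ifs with h
  · obtain ⟨t, ht, rfl⟩ := h
    obtain ⟨h0, h1, h2, hs⟩ := mem_properCubes.1 ht
    have hne : t ≠ t⁻¹ := by
      intro h
      have : (t - 1) * (t + 1) = 0 := by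
        have := mul_inv_cancel₀ h0
        rw [← h] at this
        linear_combination this
      rcases mul_eq_zero.1 this with h | h
      · exact h1 (sub_eq_zero.1 h)
      · exact h2 (eq_neg_of_add_eq_zero_left h)
    rw [← Finset.card_pair hne]
    congr 1
    ext u
    simp only [Finset.mem_filter, Finset.mem_insert, Finset.mem_singleton]
    constructor
    · rintro ⟨hu, hut⟩
      have hu0 := (mem_properCubes.1 hu).1
      have : (u - t) * (u * t - 1) = 0 := by
        field_simp at hut
        linear_combination hut
      rcases mul_eq_zero.1 this with h | h
      · exact Or.inl (sub_eq_zero.1 h)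
      · exact Or.inr (eq_inv_of_mul_eq_one_left (sub_eq_zero.1 h))
    · rintro (rfl | rfl)
      · exact ⟨ht, rfl⟩
      · refine ⟨mem_properCubes.2 ⟨inv_ne_zero h0, ?_, ?_, ?_⟩, by rw [inv_inv, add_comm]⟩
        · rwa [Ne, inv_eq_one]
        · rwa [Ne, inv_eq_iff_eq_inv, inv_neg, inv_one]
        · exact mem_nonzeroCubes.1 (inv_mem_nonzeroCubes (mem_nonzeroCubes.2 hs))
  · rw [Finset.card_eq_zero, Finset.filter_eq_empty_iff]
    exact fun t ht hz => h ⟨t, ht, hz⟩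

/-- For a fixed proper cube `t`, the number of `y ≠ 0` with `t + t⁻¹ = -2 - r y² x⁻³`. -/
theorem card_filter_ne_zero_add_inv_eq (hchar : ringChar k ≠ 2) {r x t : k} (hr : r ≠ 0)
    (hx : x ≠ 0) (ht : t ∈ properCubes k) :
    ((Finset.univ.filter fun y : k => y ≠ 0 ∧ t + t⁻¹ = -2 - r * y ^ 2 * (x ^ 3)⁻¹).card : ℂ) =
      ((quadraticChar k (-1) * quadraticChar k r * quadraticChar k x * quadraticChar k t : ℤ) : ℂ)
        + 1 := by
  obtain ⟨h0, -, h2, -⟩ := mem_properCubes.1 ht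
  have h2' : t + 1 ≠ 0 := fun h => h2 (eq_neg_of_add_eq_zero_left h)
  have hset : (Finset.univ.filter fun y : k => y ≠ 0 ∧ t + t⁻¹ = -2 - r * y ^ 2 * (x ^ 3)⁻¹) =
      Finset.univ.filter fun y : k => y ^ 2 = -1 * r * x * t * (x * (t + 1) * (r * t)⁻¹) ^ 2 := by
    ext y
    simp only [Finset.mem_filter, Finset.mem_univ, true_and]
    have key : t + t⁻¹ = -2 - r * y ^ 2 * (x ^ 3)⁻¹ ↔
        y ^ 2 = -1 * r * x * t * (x * (t + 1) * (r * t)⁻¹) ^ 2 := by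
      field_simp
      constructor <;> intro h <;> linear_combination h
    rw [key, and_iff_right_iff_imp]
    rintro h rfl
    have : -1 * r * x * t * (x * (t + 1) * (r * t)⁻¹) ^ 2 ≠ 0 := by
      simp [hr, hx, h0, h2']
    exact this (by rw [← h]; ring)
  rw [hset, card_filter_sq_eq hchar, map_mul,
    quadraticChar_sq_one' (show x * (t + 1) * (r * t)⁻¹ ≠ 0 by simp [hr, hx, h0, h2'])]
  simp only [map_mul, mul_one]

open scoped Classical in
/-- Evaluation of twice the character sum over the pairs attached to `r` via proper cubes. -/
theorem two_mul_sum_addChar_properCubes (hchar : ringChar k ≠ 2) (ψ : AddChar k ℂ) {r : k}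
    (hr : r ≠ 0) :
    2 * (∑ p ∈ Finset.univ.filter (fun p : k × k => p.1 ≠ 0 ∧ p.2 ≠ 0 ∧
        ∃ t : k, t ≠ 0 ∧ t ≠ 1 ∧ t ≠ -1 ∧ t + t⁻¹ = -2 - r * p.2 ^ 2 * (p.1 ^ 3)⁻¹ ∧
          ∃ s : k, s ≠ 0 ∧ t = s ^ 3), ψ p.1) =
      ((quadraticChar k (-1) * quadraticChar k r * ∑ t ∈ properCubes k, quadraticChar k t : ℤ) : ℂ)
          * ∑ x : k, ψ x * ((quadraticChar k x : ℤ) : ℂ) +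
        (properCubes k).card * ∑ x ∈ Finset.univ.filter (fun x : k => x ≠ 0), ψ x := by
  have hfib : ∀ x : k, x ≠ 0 →
      ∑ y : k, (if y ≠ 0 ∧ ∃ t ∈ properCubes k, t + t⁻¹ = -2 - r * y ^ 2 * (x ^ 3)⁻¹
        then (2 : ℂ) else 0) =
      ((quadraticChar k (-1) * quadraticChar k r * ∑ t ∈ properCubes k, quadraticChar k t : ℤ) : ℂ)
        * ((quadraticChar k x : ℤ) : ℂ) + (properCubes k).card := by
    intro x hx
    have h1 : ∀ y : k,
        (if y ≠ 0 ∧ ∃ t ∈ properCubes k, t + t⁻¹ = -2 - r * y ^ 2 * (x ^ 3)⁻¹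
          then (2 : ℂ) else 0) =
        ∑ t ∈ properCubes k,
          if y ≠ 0 ∧ t + t⁻¹ = -2 - r * y ^ 2 * (x ^ 3)⁻¹ then (1 : ℂ) else 0 := by
      intro y
      by_cases hy : y = 0
      · simp [hy]
      · have h := congrArg (Nat.cast : ℕ → ℂ)
          (card_filter_add_inv_eq (-2 - r * y ^ 2 * (x ^ 3)⁻¹))
        simp only [ne_eq, hy, not_false_eq_true, true_and, Finset.sum_boole]
        rw [h]
        split_ifs <;> simp
    rw [Finset.sum_congr rfl fun y _ => h1 y, Finset.sum_comm]
    have h2 : ∀ t ∈ properCubes k,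
        (∑ y : k, if y ≠ 0 ∧ t + t⁻¹ = -2 - r * y ^ 2 * (x ^ 3)⁻¹ then (1 : ℂ) else 0) =
        ((quadraticChar k (-1) * quadraticChar k r * quadraticChar k x * quadraticChar k t : ℤ) : ℂ)
          + 1 := by
      intro t ht
      rw [← card_filter_ne_zero_add_inv_eq hchar hr hx ht, Finset.sum_boole]
    rw [Finset.sum_congr rfl h2, Finset.sum_add_distrib]
    push_cast
    rw [← Finset.mul_sum, Finset.sum_const, nsmul_eq_mul]
    ring
  have hx0 : ∑ x : k, ψ x * ((quadraticChar k x : ℤ) : ℂ) =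
      ∑ x ∈ Finset.univ.filter (fun x : k => x ≠ 0), ψ x * ((quadraticChar k x : ℤ) : ℂ) := by
    rw [Finset.sum_filter]
    refine Finset.sum_congr rfl fun x _ => ?_
    by_cases hx : x = 0 <;> simp [hx]
  generalize quadraticChar k (-1) * quadraticChar k r *
    ∑ t ∈ properCubes k, quadraticChar k t = c at hfib ⊢
  rw [hx0, Finset.mul_sum _ _ (c : ℂ), Finset.mul_sum _ _ ((properCubes k).card : ℂ),
    ← Finset.sum_add_distrib, Finset.sum_filter,
    Finset.sum_filter, Fintype.sum_prod_type, Finset.mul_sum]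
  refine Finset.sum_congr rfl fun x _ => ?_
  by_cases hx : x = 0
  · simp [hx]
  rw [if_pos hx, Finset.mul_sum]
  trans ψ x * ∑ y : k,
      (if y ≠ 0 ∧ ∃ t ∈ properCubes k, t + t⁻¹ = -2 - r * y ^ 2 * (x ^ 3)⁻¹
        then (2 : ℂ) else 0)
  · rw [Finset.mul_sum]
    refine Finset.sum_congr rfl fun y _ => ?_
    have hiff : (x ≠ 0 ∧ y ≠ 0 ∧ ∃ t : k, t ≠ 0 ∧ t ≠ 1 ∧ t ≠ -1 ∧
          t + t⁻¹ = -2 - r * y ^ 2 * (x ^ 3)⁻¹ ∧ ∃ s : k, s ≠ 0 ∧ t = s ^ 3) ↔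
        (y ≠ 0 ∧ ∃ t ∈ properCubes k, t + t⁻¹ = -2 - r * y ^ 2 * (x ^ 3)⁻¹) := by
      simp only [mem_properCubes]
      constructor
      · rintro ⟨-, hy, t, a, b, c, d, e⟩
        exact ⟨hy, t, ⟨a, b, c, e⟩, d⟩
      · rintro ⟨hy, t, ⟨a, b, c, e⟩, d⟩
        exact ⟨hx, hy, t, a, b, c, d, e⟩
    simp only [hiff]
    split_ifs <;> ring
  · rw [hfib x hx]
    ring

end AddCharSums

/- Lemma A.2/A.4/A.5 (the `i = 1` case): with
`z(r, r₃, r₄) = −2 − r·r₄²·r₃⁻³` and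
`T_r = {(r₃, r₄) ∈ k^× × k^× : ∃ t ∈ k^×, t ≠ ±1, t + t⁻¹ = z(r, r₃, r₄), t a cube in k^×}`,
one has `∑_{T₁} ψ(r₃) − ∑_{T_κ} ψ(r₃) = −(1 + ε₀)·g(ψ)`. -/
open scoped Classical in
theorem gaussSum_B1_diff
    (k : Type) [Field k] [Fintype k] [DecidableEq k]
    (hchar : ringChar k ≠ 2)
    (ψ : AddChar k ℂ) (hψ : ψ ≠ 1)
    (κ : k) (hκ0 : κ ≠ 0) (hκ : ¬ IsSquare κ) :
    (∑ p ∈ Finset.univ.filter (fun p : k × k => p.1 ≠ 0 ∧ p.2 ≠ 0 ∧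
        ∃ t : k, t ≠ 0 ∧ t ≠ 1 ∧ t ≠ -1 ∧ t + t⁻¹ = -2 - 1 * p.2 ^ 2 * (p.1 ^ 3)⁻¹ ∧
          ∃ s : k, s ≠ 0 ∧ t = s ^ 3), ψ p.1) -
      (∑ p ∈ Finset.univ.filter (fun p : k × k => p.1 ≠ 0 ∧ p.2 ≠ 0 ∧
        ∃ t : k, t ≠ 0 ∧ t ≠ 1 ∧ t ≠ -1 ∧ t + t⁻¹ = -2 - κ * p.2 ^ 2 * (p.1 ^ 3)⁻¹ ∧
          ∃ s : k, s ≠ 0 ∧ t = s ^ 3), ψ p.1) =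
      -(1 + ((quadraticChar k (-1) : ℤ) : ℂ)) * ∑ x : k, ψ (x ^ 2) := by
  have h1 := two_mul_sum_addChar_properCubes hchar ψ (one_ne_zero (α := k))
  have h2 := two_mul_sum_addChar_properCubes hchar ψ hκ0
  have hκ' : quadraticChar k κ = -1 := quadraticChar_neg_one_iff_not_isSquare.2 hκ
  have hneg : ((quadraticChar k (-1) : ℤ) : ℂ) ^ 2 = 1 := by
    exact_mod_cast quadraticChar_sq_one (neg_ne_zero.2 (one_ne_zero (α := k)))
  rw [sum_quadraticChar_properCubes hchar hκ0 hκ, ← sum_addChar_sq hchar hψ] at h1 h2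
  rw [map_one] at h1
  rw [hκ'] at h2
  simp only [Int.cast_mul, Int.cast_neg, Int.cast_add, Int.cast_one] at h1 h2
  linear_combination (h1 - h2) / 2 - (∑ x : k, ψ (x ^ 2)) * hneg
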